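/- Let G_a be a gamma(a) random variable with a ≥ 1, having density f(y) = y^{a−1} e^{−y} / Γ(a) on (0,∞). Then for every x with 0 < x < a − 1, P{G_a ≤ x} ≤ ( x^{a−1} e^{−x} / Γ(a) ) · 1 / ((a−1)/x − 1). -/

import Mathlib

open MeasureTheory ProbabilityTheory Real

/-- The gamma density with unit rate lies below its exponential tangent at any `x > 0`, the
tangent being taken on the logarithmic scale. -/
lemma gammaPDFReal_one_le_mul_exp {a x : ℝ} (ha : 1 ≤ a) (hx : 0 < x) (y : ℝ) :
    gammaPDFReal a 1 y ≤
      x ^ (a - 1) * exp (-x) / Gamma a * exp (((a - 1) / x - 1) * (y - x)) := by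
  have hΓ : 0 < Gamma a := Gamma_pos_of_pos (by linarith)
  unfold gammaPDFReal
  split_ifs with hy
  · have hrpow : (y / x) ^ (a - 1) ≤ exp ((a - 1) * (y / x - 1)) := by
      calc (y / x) ^ (a - 1) ≤ exp (y / x - 1) ^ (a - 1) := by
            refine rpow_le_rpow (by positivity) ?_ (by linarith)
            linarith [add_one_le_exp (y / x - 1)]
        _ = exp ((a - 1) * (y / x - 1)) := by rw [← exp_mul, mul_comm]
    have hexp : exp (-x) * exp (((a - 1) / x - 1) * (y - x)) =
        exp ((a - 1) * (y / x - 1)) * exp (-y) := by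
      rw [← exp_add, ← exp_add]
      congr 1
      field_simp
      ring
    calc 1 ^ a / Gamma a * y ^ (a - 1) * exp (-(1 * y))
        = x ^ (a - 1) / Gamma a * ((y / x) ^ (a - 1) * exp (-y)) := by
          rw [div_rpow hy hx.le, one_rpow, one_mul]
          have : x ^ (a - 1) ≠ 0 := (rpow_pos_of_pos hx _).ne'
          field_simp
      _ ≤ x ^ (a - 1) / Gamma a * (exp ((a - 1) * (y / x - 1)) * exp (-y)) := by gcongr
      _ = x ^ (a - 1) * exp (-x) / Gamma a * exp (((a - 1) / x - 1) * (y - x)) := by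
          rw [← hexp]; ring
  · positivity

/-- The mass to the left of `x` of an exponential with rate `c > 0` based at `x`. -/
lemma lintegral_Iic_mul_exp_sub {C c : ℝ} (hC : 0 ≤ C) (hc : 0 < c) (x : ℝ) :
    ∫⁻ y in Set.Iic x, ENNReal.ofReal (C * exp (c * (y - x))) =
      ENNReal.ofReal (C * (1 / c)) := by
  have hfun : (fun y : ℝ => C * exp (c * (y - x))) =
      fun y => C * exp (-(c * x)) * exp (c * y) := by
    funext y
    rw [mul_assoc, ← exp_add]
    ring_nf
  rw [← ofReal_integral_eq_lintegral_ofReal]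
  · rw [hfun, integral_const_mul, integral_exp_mul_Iic hc, mul_assoc, mul_div_assoc', ← exp_add,
      neg_add_cancel, exp_zero]
  · rw [hfun]
    exact (integrableOn_exp_mul_Iic hc x).const_mul _
  · exact Filter.Eventually.of_forall fun y => by positivity

/-- **Lower tail bound for the gamma distribution.**
Let `G` be a gamma(`a`) random variable (`a ≥ 1`), i.e. with density `y^(a-1) e^(-y) / Γ(a)`
on `(0,∞)`.  Then for every `0 < x < a - 1`,
`P{G ≤ x} ≤ (x^(a-1) e^(-x) / Γ(a)) / ((a-1)/x - 1)`. -/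
theorem gamma_lower_tail_bound
    {Ω : Type*} [MeasurableSpace Ω] (μ : Measure Ω) [IsProbabilityMeasure μ]
    (a : ℝ) (ha : 1 ≤ a)
    (G : Ω → ℝ) (hGmeas : Measurable G)
    (hG : Measure.map G μ = gammaMeasure a 1)
    (x : ℝ) (hx0 : 0 < x) (hx : x < a - 1) :
    μ {ω | G ω ≤ x} ≤
      ENNReal.ofReal
        (x ^ (a - 1) * Real.exp (-x) / Real.Gamma a * (1 / ((a - 1) / x - 1))) := by
  have hΓ : 0 < Gamma a := Gamma_pos_of_pos (by linarith)
  have hc : 0 < (a - 1) / x - 1 := sub_pos.2 ((one_lt_div hx0).2 hx)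
  calc μ {ω | G ω ≤ x} = Measure.map G μ (Set.Iic x) :=
        (Measure.map_apply hGmeas measurableSet_Iic).symm
    _ = ∫⁻ y in Set.Iic x, gammaPDF a 1 y := by
        rw [hG, gammaMeasure, withDensity_apply _ measurableSet_Iic]
    _ ≤ ∫⁻ y in Set.Iic x, ENNReal.ofReal
          (x ^ (a - 1) * exp (-x) / Gamma a * exp (((a - 1) / x - 1) * (y - x))) :=
        lintegral_mono fun y => ENNReal.ofReal_le_ofReal (gammaPDFReal_one_le_mul_exp ha hx0 y)
    _ = _ := lintegral_Iic_mul_exp_sub (by positivity) hc x
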